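/- Consider Algorithm 1 run on an n-vertex graph G with maximum degree Δ. Condition on the values of χ, L_1 and π, and suppose that in the course of running DegreeOracle_π(v, x⃗) a total of t calls to EdgeOracle_π(e, x⃗) with e ∈ L_1 are made. Then the conditional expectation (over L ∖ L_1) of the total number of entries of x⃗ queried during DegreeOracle_π(v, x⃗) is at most C·(Δ^{1.15} + t·Δ^{0.15}) for a universal constant C. -/

import Mathlib

open Finset
open scoped Classical

section Defs

private lemma sym2_exists_mem {V : Type*} (e : Sym2 V) : ∃ a, a ∈ e :=
  ⟨(Quot.out e).1, Sym2.out_fst_mem e⟩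

variable {V : Type*} [Fintype V] [DecidableEq V]

/-- The greedy maximal matching of the graph with edge set `E`, processing edges in
increasing order of the priority function `ρ`: repeatedly pick the minimum-priority
remaining edge, add it to the matching, and discard all edges meeting it. -/
noncomputable def greedyMM {β : Type*} [LinearOrder β] (ρ : Sym2 V → β) (E : Finset (Sym2 V)) :
    Finset (Sym2 V) :=
  if h : E.Nonempty then
    insert (Classical.choose (E.exists_min_image ρ h))
      (greedyMM ρ (E.filter fun f =>
        ¬ ∃ v, v ∈ Classical.choose (E.exists_min_image ρ h) ∧ v ∈ f))
  else ∅
termination_by E.card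
decreasing_by
  have he : Classical.choose (E.exists_min_image ρ h) ∈ E :=
    (Classical.choose_spec (E.exists_min_image ρ h)).1
  apply Finset.card_lt_card
  refine (Finset.ssubset_iff_of_subset (Finset.filter_subset _ _)).2 ⟨_, he, ?_⟩
  intro hmem
  obtain ⟨a, ha⟩ := sym2_exists_mem (Classical.choose (E.exists_min_image ρ h))
  exact (Finset.mem_filter.1 hmem).2 ⟨a, ha, ha⟩

/-- The set of vertices matched by a set `M` of edges. -/
noncomputable def matchedV (M : Finset (Sym2 V)) : Finset V :=
  Finset.univ.filter fun v => ∃ e ∈ M, v ∈ e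

/-- Residual degree of `v` with respect to the matching `M` in the graph with edge set `E`:
`0` if `v` is matched, and otherwise the degree of `v` in the induced subgraph on
unmatched vertices. -/
noncomputable def resDeg (E M : Finset (Sym2 V)) (v : V) : ℕ :=
  if v ∈ matchedV M then 0
  else (E.filter fun e => v ∈ e ∧ ∀ w ∈ e, w ∉ matchedV M).card

/-- The number of vertices whose match-status differs between `M` and `M'`. -/
noncomputable def statusDiff (M M' : Finset (Sym2 V)) : ℕ :=
  (Finset.univ.filter fun v => ¬ (v ∈ matchedV M ↔ v ∈ matchedV M')).card


/-- The endpoints of an edge, as a finset. -/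
noncomputable def ends (e : Sym2 V) : Finset V := Finset.univ.filter (· ∈ e)

/-- The recursive edge oracle (with bookkeeping), for the graph with (sampled) edge set `L`
and priorities `π`, run with the partition-indicator vector `x`.
`eoQ π L x fuel e` returns a triple `(ans, qs, cnt)` where `ans` tells whether `e` joins the
greedy matching of the induced subgraph of `L` on `{v | x v}`, `qs` is the set of entries of
`x` queried, and `cnt` is the number of (recursive) oracle calls made on edges of `L` having
both endpoints in `{v | x v}` (including the call on `e` itself, when applicable).
The oracle first queries the two endpoints of `e` and answers NO if one of them is outside
the part; otherwise it recursively evaluates the incident edges of `L` of smaller priority,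
in increasing order of priority, stopping as soon as one of them answers YES.
It is always invoked with `fuel = π e + 1`, which guarantees the fuel never runs out. -/
noncomputable def eoQ (π : Sym2 V → ℕ) (L : Finset (Sym2 V)) (x : V → Bool) :
    ℕ → Sym2 V → Bool × Finset V × ℕ
  | 0, e => (false, ends e, 0)
  | fuel + 1, e =>
    if ∀ v ∈ e, x v then
      let nbrs := ((L.filter fun f => f ≠ e ∧ (∃ v, v ∈ e ∧ v ∈ f) ∧ π f < π e).toList.mergeSort
          (fun a b => decide (π a ≤ π b)))
      let r := nbrs.foldl (fun (s : Bool × Finset V × ℕ) f =>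
          if s.1 then s
          else
            let t := eoQ π L x fuel f
            (t.1, s.2.1 ∪ t.2.1, s.2.2 + t.2.2)) (false, ∅, 0)
      (!r.1, ends e ∪ r.2.1, (if e ∈ L then 1 else 0) + r.2.2)
    else (false, ends e, 0)

/-- Whether `e` belongs to the greedy matching, as decided by the edge oracle. -/
noncomputable def edgeOracle (π : Sym2 V → ℕ) (L : Finset (Sym2 V)) (x : V → Bool)
    (e : Sym2 V) : Bool × Finset V × ℕ :=
  eoQ π L x (π e + 1) e

/-- The degree oracle for vertex `v`: determines `Z_{v,1}`, the number of neighbors of `v`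
(in the graph with edge set `Ed`) lying in the part `{u | x u}` that are unmatched in the
greedy matching of the induced subgraph of `L`.  For each neighbor `u` of `v` it queries
`x u`, and if `x u = 1`, it runs the edge oracle on every edge of `L` incident to `u`.
Returns `(Z value, set of entries of x queried, number of oracle calls on edges inside the part)`. -/
noncomputable def degOr (Ed : Finset (Sym2 V)) (π : Sym2 V → ℕ) (L : Finset (Sym2 V))
    (x : V → Bool) (v : V) : ℕ × Finset V × ℕ :=
  let Nv := Finset.univ.filter fun u => s(u, v) ∈ Ed
  let q := Nv ∪ (Nv.filter fun u => x u).biUnion fun u =>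
      (Finset.univ.filter fun w => s(u, w) ∈ L).biUnion fun w =>
        (edgeOracle π L x s(u, w)).2.1
  let c := ∑ u ∈ Nv.filter (fun u => x u), ∑ w ∈ Finset.univ.filter (fun w => s(u, w) ∈ L),
        (edgeOracle π L x s(u, w)).2.2
  ((Nv.filter fun u => x u ∧ ∀ w ∈ Finset.univ.filter (fun w => s(u, w) ∈ L),
      (edgeOracle π L x s(u, w)).1 = false).card, q, c)

/-- `B v`: the number of entries of `x` queried during the execution of the degree oracle. -/
noncomputable def Bqueries (Ed : Finset (Sym2 V)) (π : Sym2 V → ℕ) (L : Finset (Sym2 V))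
    (x : V → Bool) (v : V) : ℕ :=
  (degOr Ed π L x v).2.1.card

/-- The priority function on edges induced by a permutation `τ` of `Fin E.card`,
via the canonical enumeration of `E`; edges outside `E` get priority `0`. -/
noncomputable def prioOf (E : Finset (Sym2 V)) (τ : Equiv.Perm (Fin E.card)) (e : Sym2 V) : ℕ :=
  if h : e ∈ E then (τ (E.equivFin ⟨e, h⟩) : ℕ) else 0

/-- `L₁`: the set of edges of `L` with both endpoints inside the part `{v | x v}`. -/
noncomputable def partEdges (L : Finset (Sym2 V)) (x : V → Bool) : Finset (Sym2 V) :=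
  L.filter fun e => ∀ v ∈ e, x v

/-- `Z_{v,1}(x)`: the number of neighbors of `v` in the graph `Ed` lying in the part
`{u | x u}` that are unmatched in `M₁ = GreedyMM(L₁, π)`. -/
noncomputable def Zv1 (Ed : Finset (Sym2 V)) (π : Sym2 V → ℕ) (L : Finset (Sym2 V))
    (x : V → Bool) (v : V) : ℕ :=
  (Finset.univ.filter fun u =>
    s(u, v) ∈ Ed ∧ x u ∧ u ∉ matchedV (greedyMM π (partEdges L x))).card


/-- The matching output by Algorithm 1: the union over all parts `i ∈ [k]` of the greedy
maximal matching (w.r.t. the priorities `π`) of the induced subgraph of the sampled edge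
set `L` on the part `V_i = χ⁻¹(i)`. -/
noncomputable def algoMatching (π : Sym2 V → ℕ) (k : ℕ) (χ : V → Fin k)
    (L : Finset (Sym2 V)) : Finset (Sym2 V) :=
  (Finset.univ : Finset (Fin k)).biUnion fun i =>
    greedyMM π (L.filter fun e => ∀ w ∈ e, χ w = i)

/-- `Z_{v,i}`: the number of neighbors of `v` in the graph `Ed` that lie in part `V_i`
and are unmatched in the matching `M` output by Algorithm 1. -/
noncomputable def Zvi (Ed : Finset (Sym2 V)) (π : Sym2 V → ℕ) (k : ℕ) (χ : V → Fin k)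
    (L : Finset (Sym2 V)) (v : V) (i : Fin k) : ℕ :=
  (Finset.univ.filter fun u =>
    s(u, v) ∈ Ed ∧ χ u = i ∧ u ∉ matchedV (algoMatching π k χ L)).card

/-- `Z'_v`: equal to `Z_{v, χ(v)}` if `v` is unmatched in the output `M` of Algorithm 1,
and `0` if `v` is matched in `M`. -/
noncomputable def Zself (Ed : Finset (Sym2 V)) (π : Sym2 V → ℕ) (k : ℕ) (χ : V → Fin k)
    (L : Finset (Sym2 V)) (v : V) : ℕ :=
  if v ∈ matchedV (algoMatching π k χ L) then 0 else Zvi Ed π k χ L v (χ v)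

/-- The Bernoulli product weight of the edge sample `S ⊆ Ed`, each edge kept with
probability `p`. -/
noncomputable def bwE (p : ℝ) (Ed S : Finset (Sym2 V)) : ℝ :=
  p ^ S.card * (1 - p) ^ (Ed.card - S.card)

/-- The Bernoulli product weight of the indicator vector `x : V → Bool`, each coordinate
equal to `true` independently with probability `q`. -/
noncomputable def bwX (q : ℝ) (x : V → Bool) : ℝ :=
  q ^ (Finset.univ.filter fun v => x v = true).card *
    (1 - q) ^ (Finset.univ.filter fun v => x v = false).card

end Defs

universe u

section ProductWeights

variable {V : Type*}

lemma bwE_nonneg {p : ℝ} (hp0 : 0 ≤ p) (hp1 : p ≤ 1) (F T : Finset (Sym2 V)) :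
    0 ≤ bwE p F T :=
  mul_nonneg (pow_nonneg hp0 _) (pow_nonneg (by linarith) _)

variable [DecidableEq V]

lemma sum_bwE (p : ℝ) (F : Finset (Sym2 V)) : ∑ T ∈ F.powerset, bwE p F T = 1 := by
  have h := Finset.prod_add (fun _ : Sym2 V => p) (fun _ => 1 - p) F
  simp only [add_sub_cancel, Finset.prod_const_one, Finset.prod_const] at h
  rw [h]
  refine Finset.sum_congr rfl fun T hT => ?_
  rw [bwE, Finset.card_sdiff_of_subset (Finset.mem_powerset.1 hT)]

/-- A fixed edge belongs to the Bernoulli sample with probability `p`. -/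
lemma sum_bwE_mem (p : ℝ) {F : Finset (Sym2 V)} {f : Sym2 V} (hf : f ∈ F) :
    ∑ T ∈ F.powerset, bwE p F T * (if f ∈ T then 1 else 0) = p := by
  have h := Finset.prod_add (fun _ : Sym2 V => p) (fun e => if e = f then 0 else 1 - p) F
  have h1 : ∏ e ∈ F, (p + if e = f then 0 else 1 - p) = p := by
    rw [Finset.prod_eq_single_of_mem f hf]
    · simp
    · intro e _ hne
      simp [hne]
  rw [h1] at h
  conv_rhs => rw [h]
  refine Finset.sum_congr rfl fun T hT => ?_
  have hT' := Finset.mem_powerset.1 hT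
  by_cases hfT : f ∈ T
  · have h2 : ∏ e ∈ F \ T, (if e = f then 0 else 1 - p) = (1 - p) ^ (F.card - T.card) := by
      rw [← Finset.card_sdiff_of_subset hT', ← Finset.prod_const]
      refine Finset.prod_congr rfl fun e he => if_neg ?_
      rintro rfl
      exact (Finset.mem_sdiff.1 he).2 hfT
    rw [h2]
    simp [hfT, bwE]
  · have h2 : ∏ e ∈ F \ T, (if e = f then 0 else 1 - p) = 0 :=
      Finset.prod_eq_zero (Finset.mem_sdiff.2 ⟨hf, hfT⟩) (by simp)
    rw [h2]
    simp [hfT]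

/-- The expected number of sampled edges satisfying `P` is `p` times the number of such edges. -/
lemma sum_bwE_card_filter (p : ℝ) (F : Finset (Sym2 V)) (P : Sym2 V → Prop)
    [DecidablePred P] :
    ∑ T ∈ F.powerset, bwE p F T * ((T.filter P).card : ℝ) = p * (F.filter P).card := by
  have h : ∀ T ∈ F.powerset, bwE p F T * ((T.filter P).card : ℝ) =
      ∑ f ∈ F.filter P, bwE p F T * (if f ∈ T then 1 else 0) := by
    intro T hT
    rw [← Finset.mul_sum, Finset.sum_boole]
    congr 3
    ext f
    have := @Finset.mem_powerset.1 hT f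
    simp only [Finset.mem_filter]
    tauto
  rw [Finset.sum_congr rfl h, Finset.sum_comm,
    Finset.sum_congr rfl fun f hf => sum_bwE_mem p (Finset.mem_filter.1 hf).1]
  simp [mul_comm]

end ProductWeights

section QuerySets

variable {V : Type*} [Fintype V] [DecidableEq V]

lemma mem_ends {e : Sym2 V} {w : V} : w ∈ ends e ↔ w ∈ e := by simp [ends]

lemma card_ends_le (e : Sym2 V) : (ends e).card ≤ 2 := by
  induction e using Sym2.ind with
  | _ a b =>
    refine (Finset.card_le_card fun w hw => ?_).trans (Finset.card_le_two (a := a) (b := b))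
    simpa [mem_ends] using hw

/-- `A` together with the endpoints of all edges of `T` meeting `A`. -/
noncomputable def edgeClosure (T : Finset (Sym2 V)) (A : Finset V) : Finset V :=
  A ∪ (T.filter fun f => ∃ w ∈ A, w ∈ f).biUnion ends

lemma mem_edgeClosure {T : Finset (Sym2 V)} {A : Finset V} {u : V} :
    u ∈ edgeClosure T A ↔ u ∈ A ∨ ∃ f ∈ T, (∃ w ∈ A, w ∈ f) ∧ u ∈ f := by
  simp [edgeClosure, mem_ends, and_assoc]

lemma subset_edgeClosure (T : Finset (Sym2 V)) (A : Finset V) : A ⊆ edgeClosure T A :=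
  Finset.subset_union_left

lemma edgeClosure_mono (T : Finset (Sym2 V)) {A B : Finset V} (h : A ⊆ B) :
    edgeClosure T A ⊆ edgeClosure T B := by
  intro u hu
  rw [mem_edgeClosure] at hu ⊢
  rcases hu with hu | ⟨f, hf, ⟨w, hw, hwf⟩, hu⟩
  · exact Or.inl (h hu)
  · exact Or.inr ⟨f, hf, ⟨w, h hw, hwf⟩, hu⟩

lemma ends_subset_edgeClosure {T : Finset (Sym2 V)} {A : Finset V} {f : Sym2 V} (hf : f ∈ T)
    {w : V} (hw : w ∈ A) (hwf : w ∈ f) : ends f ⊆ edgeClosure T A := fun _ hu =>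
  mem_edgeClosure.2 (Or.inr ⟨f, hf, ⟨w, hw, hwf⟩, mem_ends.1 hu⟩)

lemma card_edgeClosure_le (T : Finset (Sym2 V)) (A : Finset V) :
    (edgeClosure T A).card ≤ A.card + 2 * ∑ w ∈ A, (T.filter fun f => w ∈ f).card := by
  refine (Finset.card_union_le _ _).trans (Nat.add_le_add_left ?_ _)
  have h1 : ((T.filter fun f => ∃ w ∈ A, w ∈ f).biUnion ends).card ≤
      (T.filter fun f => ∃ w ∈ A, w ∈ f).card * 2 :=
    Finset.card_biUnion_le_card_mul _ _ _ fun e _ => card_ends_le e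
  have h2 : (T.filter fun f => ∃ w ∈ A, w ∈ f) ⊆ A.biUnion fun w => T.filter fun f => w ∈ f := by
    intro f hf
    obtain ⟨hfT, w, hw, hwf⟩ := Finset.mem_filter.1 hf
    exact Finset.mem_biUnion.2 ⟨w, hw, Finset.mem_filter.2 ⟨hfT, hwf⟩⟩
  have h3 := (Finset.card_le_card h2).trans Finset.card_biUnion_le
  omega

/-- The expected size of the closure of `A` under a Bernoulli sample of the edge set `F`. -/
lemma sum_bwE_card_edgeClosure_le {p : ℝ} (hp0 : 0 ≤ p) (hp1 : p ≤ 1) (F : Finset (Sym2 V))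
    {d : ℕ} (hd : ∀ v : V, (F.filter fun e => v ∈ e).card ≤ d) (A : Finset V) :
    ∑ T ∈ F.powerset, bwE p F T * ((edgeClosure T A).card : ℝ) ≤
      A.card * (1 + 2 * (p * d)) := by
  have h : ∀ T ∈ F.powerset, bwE p F T * ((edgeClosure T A).card : ℝ) ≤
      bwE p F T * A.card + 2 * ∑ w ∈ A, bwE p F T * ((T.filter fun f => w ∈ f).card : ℝ) := by
    intro T _
    rw [← Finset.mul_sum]
    have h1 : ((edgeClosure T A).card : ℝ) ≤
        A.card + 2 * ∑ w ∈ A, ((T.filter fun f => w ∈ f).card : ℝ) := by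
      exact_mod_cast card_edgeClosure_le T A
    have h2 := mul_le_mul_of_nonneg_left h1 (bwE_nonneg hp0 hp1 F T)
    linarith
  refine (Finset.sum_le_sum h).trans ?_
  rw [Finset.sum_add_distrib, ← Finset.sum_mul, sum_bwE, ← Finset.mul_sum, Finset.sum_comm,
    Finset.sum_congr rfl fun w _ => sum_bwE_card_filter p F fun f => w ∈ f]
  have h3 : ∑ w ∈ A, p * ((F.filter fun f => w ∈ f).card : ℝ) ≤ ∑ _w ∈ A, p * d :=
    Finset.sum_le_sum fun w _ => mul_le_mul_of_nonneg_left (by exact_mod_cast hd w) hp0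
  rw [Finset.sum_const, nsmul_eq_mul] at h3
  linarith

end QuerySets

section OracleFold

variable {V : Type*} [DecidableEq V]

/-- One step of the edge oracle's loop over smaller-priority incident edges, where `g f` is
the outcome of the recursive call on `f`. -/
def oracleStep (g : Sym2 V → Bool × Finset V × ℕ) (s : Bool × Finset V × ℕ) (f : Sym2 V) :
    Bool × Finset V × ℕ :=
  if s.1 then s else ((g f).1, s.2.1 ∪ (g f).2.1, s.2.2 + (g f).2.2)

/-- Edges on which `g` answers NO at no cost do not influence the answer or the count. -/
lemma foldl_oracleStep_filter {g h : Sym2 V → Bool × Finset V × ℕ} {P : Sym2 V → Prop}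
    [DecidablePred P] {cl : Finset V → Finset V} (hcl : Monotone cl) {B : Finset V} {l : List (Sym2 V)}
    (hP : ∀ f ∈ l, P f → (g f).1 = (h f).1 ∧ (g f).2.2 = (h f).2.2 ∧ (g f).2.1 ⊆ cl (h f).2.1)
    (hN : ∀ f ∈ l, ¬ P f → (g f).1 = false ∧ (g f).2.2 = 0 ∧ (g f).2.1 ⊆ B)
    {s s' : Bool × Finset V × ℕ} (h1 : s.1 = s'.1) (h2 : s.2.2 = s'.2.2)
    (h3 : s.2.1 ⊆ B ∪ cl s'.2.1) :
    (l.foldl (oracleStep g) s).1 = ((l.filter P).foldl (oracleStep h) s').1 ∧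
    (l.foldl (oracleStep g) s).2.2 = ((l.filter P).foldl (oracleStep h) s').2.2 ∧
    (l.foldl (oracleStep g) s).2.1 ⊆ B ∪ cl ((l.filter P).foldl (oracleStep h) s').2.1 := by
  induction l generalizing s s' with
  | nil => exact ⟨h1, h2, h3⟩
  | cons f l ih =>
    replace ih := @ih (fun f hf => hP f (List.mem_cons_of_mem _ hf))
      (fun f hf => hN f (List.mem_cons_of_mem _ hf))
    by_cases hf : P f
    · obtain ⟨e1, e2, e3⟩ := hP f List.mem_cons_self hf
      rw [List.filter_cons_of_pos (by simpa using hf), List.foldl_cons, List.foldl_cons]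
      by_cases hs : s.1
      · have hs' : s'.1 = true := h1 ▸ hs
        apply ih <;> simp [oracleStep, hs, hs', h2, h3]
      · have hs' : ¬ s'.1 = true := h1 ▸ hs
        apply ih
        · simp [oracleStep, hs, hs', e1]
        · simp [oracleStep, hs, hs', e2, h2]
        · simp only [oracleStep, hs, hs']
          refine Finset.union_subset (h3.trans ?_) (e3.trans ?_)
          · exact Finset.union_subset_union_right (hcl Finset.subset_union_left)
          · exact (hcl Finset.subset_union_right).trans Finset.subset_union_right
    · obtain ⟨e1, e2, e3⟩ := hN f List.mem_cons_self hf
      rw [List.filter_cons_of_neg (by simpa using hf), List.foldl_cons]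
      by_cases hs : s.1
      · have hs' : s'.1 = true := h1 ▸ hs
        apply ih <;> simp [oracleStep, hs, hs', h2, h3]
      · apply ih
        · rw [← h1]
          simp [oracleStep, hs, e1]
        · simp [oracleStep, hs, e2, h2]
        · simp only [oracleStep, hs]
          exact Finset.union_subset h3 (e3.trans Finset.subset_union_left)

lemma card_foldl_oracleStep_le {h : Sym2 V → Bool × Finset V × ℕ} {l : List (Sym2 V)}
    (hl : ∀ f ∈ l, (h f).2.1.card ≤ 2 * (h f).2.2) {s : Bool × Finset V × ℕ}
    (hs : s.2.1.card ≤ 2 * s.2.2) :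
    (l.foldl (oracleStep h) s).2.1.card ≤ 2 * (l.foldl (oracleStep h) s).2.2 := by
  induction l generalizing s with
  | nil => exact hs
  | cons f l ih =>
    rw [List.foldl_cons]
    refine ih (fun f hf => hl f (List.mem_cons_of_mem _ hf)) ?_
    unfold oracleStep
    split_ifs
    · exact hs
    · have := hl f List.mem_cons_self
      have := Finset.card_union_le s.2.1 (h f).2.1
      simp only
      omega

end OracleFold

section Oracle

variable {V : Type*} [Fintype V] [DecidableEq V]

/-- The edges of `L` meeting `e` with smaller priority, in increasing order of priority. -/
noncomputable def lowerEdges (π : Sym2 V → ℕ) (L : Finset (Sym2 V)) (e : Sym2 V) :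
    List (Sym2 V) :=
  (L.filter fun f => f ≠ e ∧ (∃ v, v ∈ e ∧ v ∈ f) ∧ π f < π e).toList.mergeSort
    (fun a b => decide (π a ≤ π b))

lemma mem_lowerEdges {π : Sym2 V → ℕ} {L : Finset (Sym2 V)} {e f : Sym2 V} :
    f ∈ lowerEdges π L e ↔ f ∈ L ∧ f ≠ e ∧ (∃ v, v ∈ e ∧ v ∈ f) ∧ π f < π e := by
  simp [lowerEdges]

lemma pairwise_lowerEdges (π : Sym2 V → ℕ) (L : Finset (Sym2 V)) (e : Sym2 V) :
    (lowerEdges π L e).Pairwise fun a b => π a ≤ π b := by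
  have h := List.pairwise_mergeSort (le := fun a b : Sym2 V => decide (π a ≤ π b))
    (fun a b c => by simpa using le_trans) (fun a b => by simpa using le_total _ _)
  simp only [decide_eq_true_eq] at h
  exact h _

lemma nodup_lowerEdges (π : Sym2 V → ℕ) (L : Finset (Sym2 V)) (e : Sym2 V) :
    (lowerEdges π L e).Nodup :=
  (List.mergeSort_perm _ _).nodup_iff.2 (Finset.nodup_toList _)

lemma lowerEdges_filter {π : Sym2 V → ℕ} {L L₁ : Finset (Sym2 V)} (hL : L₁ ⊆ L)
    (hπ : Set.InjOn π ↑L) (e : Sym2 V) :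
    (lowerEdges π L e).filter (· ∈ L₁) = lowerEdges π L₁ e := by
  refine List.Perm.eq_of_pairwise (le := fun a b => π a ≤ π b) ?_
    ((pairwise_lowerEdges π L e).filter _) (pairwise_lowerEdges π L₁ e) ?_
  · intro a b ha hb hab hba
    exact hπ (mem_lowerEdges.1 (List.mem_of_mem_filter ha)).1 (hL (mem_lowerEdges.1 hb).1)
      (le_antisymm hab hba)
  · rw [List.perm_ext_iff_of_nodup ((nodup_lowerEdges π L e).filter _) (nodup_lowerEdges π L₁ e)]
    intro f
    have := @hL f
    simp only [List.mem_filter, mem_lowerEdges, decide_eq_true_eq]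
    tauto

lemma eoQ_succ_of_forall {π : Sym2 V → ℕ} {L : Finset (Sym2 V)} {x : V → Bool} {e : Sym2 V}
    (he : ∀ v ∈ e, x v) (n : ℕ) :
    eoQ π L x (n + 1) e =
      (!((lowerEdges π L e).foldl (oracleStep (eoQ π L x n)) (false, ∅, 0)).1,
        ends e ∪ ((lowerEdges π L e).foldl (oracleStep (eoQ π L x n)) (false, ∅, 0)).2.1,
        (if e ∈ L then 1 else 0) +
          ((lowerEdges π L e).foldl (oracleStep (eoQ π L x n)) (false, ∅, 0)).2.2) := by
  rw [eoQ, if_pos he]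
  rfl

lemma eoQ_of_not_forall {π : Sym2 V → ℕ} {L : Finset (Sym2 V)} {x : V → Bool} {e : Sym2 V}
    (he : ¬ ∀ v ∈ e, x v) (n : ℕ) : eoQ π L x n e = (false, ends e, 0) := by
  cases n with
  | zero => rw [eoQ]
  | succ n => rw [eoQ, if_neg he]

/-- Adding edges `T` not inside the part changes neither the answer nor the number of calls on
edges inside the part; the additional queries are endpoints of edges of `T` meeting queried
vertices. -/
lemma eoQ_union {π : Sym2 V → ℕ} {L₁ T : Finset (Sym2 V)} {x : V → Bool}
    (hπ : Set.InjOn π ↑(L₁ ∪ T)) (hT : ∀ e ∈ T, ¬ ∀ w ∈ e, x w) (n : ℕ) (e : Sym2 V) :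
    (eoQ π (L₁ ∪ T) x n e).1 = (eoQ π L₁ x n e).1 ∧
    (eoQ π (L₁ ∪ T) x n e).2.2 = (eoQ π L₁ x n e).2.2 ∧
    (eoQ π (L₁ ∪ T) x n e).2.1 ⊆ edgeClosure T (eoQ π L₁ x n e).2.1 := by
  induction n generalizing e with
  | zero => simp only [eoQ]; exact ⟨trivial, trivial, subset_edgeClosure _ _⟩
  | succ n ih =>
    by_cases he : ∀ w ∈ e, x w
    swap
    · simp only [eoQ_of_not_forall he]
      exact ⟨trivial, trivial, subset_edgeClosure _ _⟩
    have heT : e ∉ T := fun h => hT e h he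
    have key := foldl_oracleStep_filter (g := eoQ π (L₁ ∪ T) x n) (h := eoQ π L₁ x n)
      (P := (· ∈ L₁)) (cl := edgeClosure T) (fun _ _ h => edgeClosure_mono T h)
      (B := edgeClosure T (ends e)) (l := lowerEdges π (L₁ ∪ T) e) (fun f _ _ => ih f)
      (fun f hf hf1 => by
        obtain ⟨hfL, -, ⟨w, hwe, hwf⟩, -⟩ := mem_lowerEdges.1 hf
        have hfT : f ∈ T := (Finset.mem_union.1 hfL).resolve_left hf1
        rw [eoQ_of_not_forall (hT f hfT)]
        exact ⟨rfl, rfl, ends_subset_edgeClosure hfT (mem_ends.2 hwe) hwf⟩)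
      (s := (false, ∅, 0)) (s' := (false, ∅, 0)) rfl rfl (Finset.empty_subset _)
    rw [lowerEdges_filter Finset.subset_union_left hπ] at key
    obtain ⟨k1, k2, k3⟩ := key
    rw [eoQ_succ_of_forall he, eoQ_succ_of_forall he]
    refine ⟨by simp only [k1], by simp [k2, heT], ?_⟩
    refine Finset.union_subset ?_ (k3.trans (Finset.union_subset ?_ ?_))
    · exact Finset.subset_union_left.trans (subset_edgeClosure _ _)
    · exact edgeClosure_mono T Finset.subset_union_left
    · exact edgeClosure_mono T Finset.subset_union_right

/-- When all edges lie inside the part, each oracle call accounts for at most two queries. -/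
lemma card_eoQ_le {π : Sym2 V → ℕ} {L₁ : Finset (Sym2 V)} {x : V → Bool}
    (hL₁ : ∀ e ∈ L₁, ∀ w ∈ e, x w) {n : ℕ} {e : Sym2 V} (he : e ∈ L₁) (hn : π e < n) :
    (eoQ π L₁ x n e).2.1.card ≤ 2 * (eoQ π L₁ x n e).2.2 := by
  induction n generalizing e with
  | zero => omega
  | succ n ih =>
    rw [eoQ_succ_of_forall (hL₁ e he)]
    have h1 := card_foldl_oracleStep_le (h := eoQ π L₁ x n) (l := lowerEdges π L₁ e)
      (fun f hf => ih (mem_lowerEdges.1 hf).1 (by have := (mem_lowerEdges.1 hf).2.2.2; omega))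
      (s := (false, ∅, 0)) (by simp)
    have h2 := card_ends_le e
    refine (Finset.card_union_le _ _).trans ?_
    simp only [he, if_true]
    omega

lemma degOr_queries_union_subset {E : Finset (Sym2 V)} {π : Sym2 V → ℕ}
    {L₁ T : Finset (Sym2 V)} {x : V → Bool} (hπ : Set.InjOn π ↑(L₁ ∪ T))
    (hT : ∀ e ∈ T, ¬ ∀ w ∈ e, x w) (v : V) :
    (degOr E π (L₁ ∪ T) x v).2.1 ⊆ edgeClosure T (degOr E π L₁ x v).2.1 := by
  simp only [degOr]
  refine Finset.union_subset (Finset.subset_union_left.trans (subset_edgeClosure _ _)) ?_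
  refine Finset.biUnion_subset.2 fun u hu => Finset.biUnion_subset.2 fun w hw => ?_
  have huN := (Finset.mem_filter.1 hu).1
  rcases Finset.mem_union.1 (Finset.mem_filter.1 hw).2 with hw1 | hwT
  · refine (eoQ_union hπ hT _ _).2.2.trans (edgeClosure_mono T ?_)
    refine Finset.Subset.trans ?_ Finset.subset_union_right
    refine Finset.Subset.trans ?_ (Finset.subset_biUnion_of_mem _ hu)
    exact Finset.subset_biUnion_of_mem (fun w => (edgeOracle π L₁ x s(u, w)).2.1)
      (Finset.mem_filter.2 ⟨Finset.mem_univ w, hw1⟩)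
  · rw [edgeOracle, eoQ_of_not_forall (hT _ hwT)]
    exact ends_subset_edgeClosure hwT (Finset.mem_union_left _ huN) (Sym2.mem_mk_left u w)

lemma card_neighbors_le (E : Finset (Sym2 V)) (v : V) :
    (Finset.univ.filter fun u => s(u, v) ∈ E).card ≤ (E.filter fun e => v ∈ e).card := by
  refine Finset.card_le_card_of_injOn (fun u => s(u, v)) ?_ ?_
  · intro u hu
    simpa using hu
  · intro a _ b _ hab
    exact Sym2.congr_left.1 hab

lemma card_degOr_queries_le {E : Finset (Sym2 V)} {π : Sym2 V → ℕ} {L₁ : Finset (Sym2 V)}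
    {x : V → Bool} (hL₁ : ∀ e ∈ L₁, ∀ w ∈ e, x w) (v : V) :
    (degOr E π L₁ x v).2.1.card ≤
      (E.filter fun e => v ∈ e).card + 2 * (degOr E π L₁ x v).2.2 := by
  simp only [degOr]
  refine (Finset.card_union_le _ _).trans (Nat.add_le_add (card_neighbors_le E v) ?_)
  rw [Finset.mul_sum]
  refine Finset.card_biUnion_le.trans (Finset.sum_le_sum fun u _ => ?_)
  rw [Finset.mul_sum]
  refine Finset.card_biUnion_le.trans (Finset.sum_le_sum fun w hw => ?_)
  exact card_eoQ_le hL₁ (Finset.mem_filter.1 hw).2 (Nat.lt_succ_self _)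

end Oracle

/-- **From `L₁`-oracle calls to queried entries of `x⃗`** (Claim 4.6).
There is a universal constant `C > 0` such that the following holds.  Run Algorithm 1 on a
graph `G = (V, E)` with maximum degree `Δ` (edge-sampling probability `p = Δ^{-0.85}`).
Condition on the permutation `π`, the partition (through the indicator vector `x⃗` of `V₁`)
and on `L₁` (the set of sampled edges with both endpoints in `V₁`), and suppose that in the
course of running `DegreeOracle_π(v, x⃗)` a total of `t` calls to `EdgeOracle_π(e, x⃗)` with
`e ∈ L₁` are made.  Then the conditional expectation — over the remaining sample
`L ∖ L₁`, i.e. a Bernoulli-`p` subset `T` of the edges of `E` not inside `V₁` — of the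
total number of entries of `x⃗` queried during `DegreeOracle_π(v, x⃗)` is at most
`C·(Δ^{1.15} + t·Δ^{0.15})`. -/
theorem degree_oracle_expected_queries_given_L1_calls :
    ∃ C : ℝ, 0 < C ∧
      ∀ (V : Type u) [Fintype V] [DecidableEq V]
        (E : Finset (Sym2 V)) (_ : ∀ e ∈ E, ¬ e.IsDiag)
        (Δ : ℕ) (_ : ∀ v : V, (E.filter fun e => v ∈ e).card ≤ Δ) (_ : 1 ≤ Δ)
        (p : ℝ) (_ : p = (Δ : ℝ) ^ (-(0.85 : ℝ)))
        (π : Sym2 V → ℕ) (_ : Set.InjOn π ↑E)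
        (x : V → Bool) (L₁ : Finset (Sym2 V)) (_ : L₁ ⊆ E)
        (_ : ∀ e ∈ L₁, ∀ w ∈ e, x w) (v : V) (t : ℕ)
        (_ : ∀ T ∈ (E.filter fun e => ¬ ∀ w ∈ e, x w).powerset,
          (degOr E π (L₁ ∪ T) x v).2.2 = t),
        ∑ T ∈ (E.filter fun e => ¬ ∀ w ∈ e, x w).powerset,
            bwE p (E.filter fun e => ¬ ∀ w ∈ e, x w) T *
              ((degOr E π (L₁ ∪ T) x v).2.1.card : ℝ) ≤
          C * ((Δ : ℝ) ^ ((1.15 : ℝ)) + t * (Δ : ℝ) ^ ((0.15 : ℝ))) := by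
  refine ⟨6, by norm_num, ?_⟩
  intro V _ _ E _ Δ hΔ hΔ1 p hp π hπ x L₁ hL₁E hL₁ v t ht
  set F := E.filter fun e => ¬ ∀ w ∈ e, x w with hF
  have hΔ1' : (1 : ℝ) ≤ Δ := by exact_mod_cast hΔ1
  have hΔ0 : (0 : ℝ) < Δ := by linarith
  have hp0 : 0 ≤ p := hp ▸ Real.rpow_nonneg hΔ0.le _
  have hp1 : p ≤ 1 := hp ▸ Real.rpow_le_one_of_one_le_of_nonpos hΔ1' (by norm_num)
  have hpΔ : p * Δ = (Δ : ℝ) ^ (0.15 : ℝ) := by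
    rw [hp, ← Real.rpow_add_one hΔ0.ne']
    norm_num
  have hΔpow : (Δ : ℝ) * (Δ : ℝ) ^ (0.15 : ℝ) = (Δ : ℝ) ^ (1.15 : ℝ) := by
    rw [mul_comm, ← Real.rpow_add_one hΔ0.ne']
    norm_num
  have hone : 1 ≤ (Δ : ℝ) ^ (0.15 : ℝ) := Real.one_le_rpow hΔ1' (by norm_num)
  have hFd : ∀ w : V, (F.filter fun e => w ∈ e).card ≤ Δ := fun w =>
    (Finset.card_le_card (Finset.filter_subset_filter _ (Finset.filter_subset _ _))).trans (hΔ w)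
  set A := (degOr E π L₁ x v).2.1 with hA
  have hAcard : (A.card : ℝ) ≤ Δ + 2 * t := by
    have h0 : (degOr E π L₁ x v).2.2 = t := by
      simpa using ht ∅ (Finset.empty_mem_powerset _)
    have h1 := card_degOr_queries_le (E := E) (π := π) hL₁ v
    rw [h0] at h1
    exact_mod_cast h1.trans (Nat.add_le_add_right (hΔ v) _)
  calc ∑ T ∈ F.powerset, bwE p F T * ((degOr E π (L₁ ∪ T) x v).2.1.card : ℝ)
      ≤ ∑ T ∈ F.powerset, bwE p F T * ((edgeClosure T A).card : ℝ) := by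
        refine Finset.sum_le_sum fun T hT => ?_
        have hTF := Finset.mem_powerset.1 hT
        refine mul_le_mul_of_nonneg_left ?_ (bwE_nonneg hp0 hp1 F T)
        have hsub : (L₁ ∪ T) ⊆ E :=
          Finset.union_subset hL₁E (hTF.trans (Finset.filter_subset _ _))
        exact_mod_cast Finset.card_le_card (degOr_queries_union_subset
          (hπ.mono (Finset.coe_subset.2 hsub)) (fun e he => (Finset.mem_filter.1 (hTF he)).2) v)
    _ ≤ A.card * (1 + 2 * (p * Δ)) := sum_bwE_card_edgeClosure_le hp0 hp1 F hFd A
    _ ≤ (Δ + 2 * t) * (3 * (Δ : ℝ) ^ (0.15 : ℝ)) := by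
        rw [hpΔ]
        gcongr
        linarith
    _ ≤ 6 * ((Δ : ℝ) ^ (1.15 : ℝ) + t * (Δ : ℝ) ^ (0.15 : ℝ)) := by
        rw [← hΔpow]
        have : 0 ≤ (Δ : ℝ) * (Δ : ℝ) ^ (0.15 : ℝ) := by positivity
        linarith
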